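/- arXiv:1803.07611 — 2 statements merged into one kernel-verified Lean document; each statement's English description precedes it below -/
import Mathlib

section
/- Let τ₁, τ₂ be complex numbers that are linearly independent over ℝ, let z₁₁, z₁₂, z₂₁, z₂₂ be complex numbers, and let p₁, p₂, q₁, q₂, r₁, r₂, s₁, s₂ be integers satisfying (p₁τ₁+p₂τ₂)z₁₁ + (q₁τ₁+q₂τ₂)z₂₁ = r₁τ₁+r₂τ₂ and (p₁τ₁+p₂τ₂)z₁₂ + (q₁τ₁+q₂τ₂)z₂₂ = s₁τ₁+s₂τ₂. Then (r₁s₂−s₁r₂) + (s₁p₂−p₁s₂)z₁₁ + (p₁r₂−r₁p₂)z₁₂ + (s₁q₂−q₁s₂)z₂₁ + (q₁r₂−r₁q₂)z₂₂ + (p₁q₂−q₁p₂)(z₁₁z₂₂−z₁₂z₂₁) = 0. -/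
/-- Elimination identity (eqn 2.6): if `τ₁, τ₂` are ℝ-linearly independent complex
numbers and the integers `p, q, r, s` satisfy the two period relations, then the
determinant of the resulting 2×2 linear system in `(τ₁, τ₂)` vanishes. -/
theorem elimination_identity (τ₁ τ₂ : ℂ)
    (hind : LinearIndependent ℝ ![τ₁, τ₂])
    (z₁₁ z₁₂ z₂₁ z₂₂ : ℂ) (p₁ p₂ q₁ q₂ r₁ r₂ s₁ s₂ : ℤ)
    (h1 : ((p₁ : ℂ) * τ₁ + (p₂ : ℂ) * τ₂) * z₁₁ + ((q₁ : ℂ) * τ₁ + (q₂ : ℂ) * τ₂) * z₂₁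
            = (r₁ : ℂ) * τ₁ + (r₂ : ℂ) * τ₂)
    (h2 : ((p₁ : ℂ) * τ₁ + (p₂ : ℂ) * τ₂) * z₁₂ + ((q₁ : ℂ) * τ₁ + (q₂ : ℂ) * τ₂) * z₂₂
            = (s₁ : ℂ) * τ₁ + (s₂ : ℂ) * τ₂) :
    ((r₁ * s₂ - s₁ * r₂ : ℤ) : ℂ)
      + ((s₁ * p₂ - p₁ * s₂ : ℤ) : ℂ) * z₁₁
      + ((p₁ * r₂ - r₁ * p₂ : ℤ) : ℂ) * z₁₂
      + ((s₁ * q₂ - q₁ * s₂ : ℤ) : ℂ) * z₂₁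
      + ((q₁ * r₂ - r₁ * q₂ : ℤ) : ℂ) * z₂₂
      + ((p₁ * q₂ - q₁ * p₂ : ℤ) : ℂ) * (z₁₁ * z₂₂ - z₁₂ * z₂₁) = 0 := by
  have hτ : τ₁ ≠ 0 := hind.ne_zero 0
  refine (mul_eq_zero.mp ?_).resolve_right hτ
  push_cast
  linear_combination (p₂ * z₁₂ + q₂ * z₂₂ - s₂) * h1 - (p₂ * z₁₁ + q₂ * z₂₁ - r₂) * h2
end

section
/- Let Z₁ be the 2×2 complex matrix with rows (√5·i, √2·i) and (√7·i, √3·i). Then: (1) det(Im Z₁) = √15 − √14 > 0, so Z₁ ∈ M; (2) Z₁ ∉ S_n for every integer n ≥ 1; and (3) Z₁ ∉ R_m for every admissible sextuple m of integers. Hence Z₁ ∈ M₀, i.e., Siegel's torus T_{Z₁} lies in the set of tori with no nonconstant meromorphic functions. -/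
open Complex

/-- The moduli space `M` of 2×2 complex matrices `Z` with `det (Im Z) > 0`. -/
def Mset : Set (Matrix (Fin 2) (Fin 2) ℂ) :=
  {Z | 0 < (Matrix.of fun i j => (Z i j).im).det}

/-- `S_n = {Z ∈ M : z₂₁ = n z₁₂}`. -/
def Sn (n : ℕ) : Set (Matrix (Fin 2) (Fin 2) ℂ) :=
  {Z | Z ∈ Mset ∧ Z 1 0 = (n : ℂ) * Z 0 1}

/-- `R_m = {Z ∈ M : m₀ + m₁z₁₁ + m₂z₁₂ + m₃z₂₁ + m₄z₂₂ + m₅(z₁₁z₂₂ − z₁₂z₂₁) = 0}`. -/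
def Rm (m : Fin 6 → ℤ) : Set (Matrix (Fin 2) (Fin 2) ℂ) :=
  {Z | Z ∈ Mset ∧ (m 0 : ℂ) + (m 1 : ℂ) * Z 0 0 + (m 2 : ℂ) * Z 0 1
      + (m 3 : ℂ) * Z 1 0 + (m 4 : ℂ) * Z 1 1
      + (m 5 : ℂ) * (Z 0 0 * Z 1 1 - Z 0 1 * Z 1 0) = 0}

/-- A sextuple of integers is admissible if `m_i ≠ 0` for some `1 ≤ i ≤ 5`. -/
def Admissible (m : Fin 6 → ℤ) : Prop :=
  ∃ i : Fin 6, 1 ≤ (i : ℕ) ∧ m i ≠ 0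

/-- `M₀ = M ∖ (S ∪ R)`: parameters of tori with no nonconstant meromorphic functions. -/
def M0 : Set (Matrix (Fin 2) (Fin 2) ℂ) :=
  Mset \ ((⋃ n : ℕ, ⋃ _ : 1 ≤ n, Sn n) ∪ (⋃ m : Fin 6 → ℤ, ⋃ _ : Admissible m, Rm m))

/-- Siegel's period matrix `Z₁`. -/
noncomputable def Z₁ : Matrix (Fin 2) (Fin 2) ℂ :=
  !![(Real.sqrt 5 : ℂ) * Complex.I, (Real.sqrt 2 : ℂ) * Complex.I;
     (Real.sqrt 7 : ℂ) * Complex.I, (Real.sqrt 3 : ℂ) * Complex.I]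

theorem intCast_add_mul_sqrt_eq_zero {n : ℕ} (hn : ¬ IsSquare n) {x y : ℤ}
    (h : (x : ℝ) + y * √(n : ℝ) = 0) : x = 0 ∧ y = 0 := by
  have hy : y = 0 := by
    by_contra hy
    exact (((irrational_sqrt_natCast_iff.2 hn).intCast_mul hy).intCast_add x).ne_zero h
  subst hy
  simpa using h

/-- `1`, `√p` and `√q` are linearly independent over `ℤ` if `p`, `q` and `p * q` are not squares. -/
theorem intCast_add_mul_sqrt_add_mul_sqrt_eq_zero {p q : ℕ} (hp : ¬ IsSquare p)
    (hq : ¬ IsSquare q) (hpq : ¬ IsSquare (p * q)) {r x y : ℤ}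
    (h : (r : ℝ) + x * √(p : ℝ) + y * √(q : ℝ) = 0) : r = 0 ∧ x = 0 ∧ y = 0 := by
  have hp2 : √(p : ℝ) ^ 2 = p := Real.sq_sqrt p.cast_nonneg
  have hq2 : √(q : ℝ) ^ 2 = q := Real.sq_sqrt q.cast_nonneg
  have hs : √((p * q : ℕ) : ℝ) = √(p : ℝ) * √(q : ℝ) := by
    rw [Nat.cast_mul, Real.sqrt_mul p.cast_nonneg]
  have hxy : 2 * x * y = 0 := by
    refine (intCast_add_mul_sqrt_eq_zero hpq (x := p * x ^ 2 + q * y ^ 2 - r ^ 2) ?_).2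
    rw [hs]
    push_cast
    linear_combination (x * √(p : ℝ) + y * √(q : ℝ) - r) * h - x ^ 2 * hp2 - y ^ 2 * hq2
  obtain rfl | rfl : x = 0 ∨ y = 0 := by simpa using hxy
  · obtain ⟨hr, hy⟩ := intCast_add_mul_sqrt_eq_zero hq (x := r) (y := y) (by simpa using h)
    exact ⟨hr, rfl, hy⟩
  · obtain ⟨hr, hx⟩ := intCast_add_mul_sqrt_eq_zero hp (x := r) (y := x) (by simpa using h)
    exact ⟨hr, hx, rfl⟩

/-- `√5`, `√2`, `√7` and `√3` are linearly independent over `ℤ`. -/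
theorem int_combination_sqrt_five_two_seven_three {a b c d : ℤ}
    (h : (a : ℝ) * √5 + b * √2 + c * √7 + d * √3 = 0) : a = 0 ∧ b = 0 ∧ c = 0 ∧ d = 0 := by
  have h5 : √(5 : ℝ) ^ 2 = 5 := Real.sq_sqrt (by norm_num)
  have h2 : √(2 : ℝ) ^ 2 = 2 := Real.sq_sqrt (by norm_num)
  have h7 : √(7 : ℝ) ^ 2 = 7 := Real.sq_sqrt (by norm_num)
  have h3 : √(3 : ℝ) ^ 2 = 3 := Real.sq_sqrt (by norm_num)
  have h10 : √(10 : ℝ) = √5 * √2 := by rw [← Real.sqrt_mul (by norm_num)]; norm_num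
  have h21 : √(21 : ℝ) = √7 * √3 := by rw [← Real.sqrt_mul (by norm_num)]; norm_num
  obtain ⟨-, hab, hcd⟩ := intCast_add_mul_sqrt_add_mul_sqrt_eq_zero (p := 10) (q := 21)
    (r := 5 * a ^ 2 + 2 * b ^ 2 - 7 * c ^ 2 - 3 * d ^ 2) (x := 2 * a * b) (y := -(2 * c * d))
    (by decide +kernel) (by decide +kernel) (by decide +kernel) (by
      push_cast [h10, h21]
      linear_combination (a * √5 + b * √2 - c * √7 - d * √3) * h
        - a ^ 2 * h5 - b ^ 2 * h2 + c ^ 2 * h7 + d ^ 2 * h3)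
  have pair {p q : ℕ} (hp : ¬ IsSquare p) (hq : ¬ IsSquare q) (hpq : ¬ IsSquare (p * q))
      {x y : ℤ} (h : (x : ℝ) * √(p : ℝ) + y * √(q : ℝ) = 0) : x = 0 ∧ y = 0 :=
    (intCast_add_mul_sqrt_add_mul_sqrt_eq_zero hp hq hpq (r := 0) (by simpa using h)).2
  obtain rfl | rfl : a = 0 ∨ b = 0 := by simpa using hab
  all_goals obtain rfl | rfl : c = 0 ∨ d = 0 := by simpa using hcd
  · have := pair (p := 2) (q := 3) (x := b) (y := d) (by decide +kernel) (by decide +kernel)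
      (by decide +kernel) (by simpa using h)
    simpa using this
  · have := pair (p := 2) (q := 7) (x := b) (y := c) (by decide +kernel) (by decide +kernel)
      (by decide +kernel) (by simpa using h)
    simpa using this
  · have := pair (p := 5) (q := 3) (x := a) (y := d) (by decide +kernel) (by decide +kernel)
      (by decide +kernel) (by simpa using h)
    simpa using this
  · have := pair (p := 5) (q := 7) (x := a) (y := c) (by decide +kernel) (by decide +kernel)
      (by decide +kernel) (by simpa using h)
    simpa using this

/-- Siegel's example: `Z₁ ∈ M`, `Z₁` lies on no `S_n` and no `R_m`, hence `Z₁ ∈ M₀`,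
i.e. the torus `T_{Z₁}` has no nonconstant meromorphic functions. -/
theorem siegel_example :
    (Matrix.of fun i j => (Z₁ i j).im).det = Real.sqrt 15 - Real.sqrt 14 ∧
    0 < Real.sqrt 15 - Real.sqrt 14 ∧
    Z₁ ∈ Mset ∧
    (∀ n : ℕ, 1 ≤ n → Z₁ ∉ Sn n) ∧
    (∀ m : Fin 6 → ℤ, Admissible m → Z₁ ∉ Rm m) ∧
    Z₁ ∈ M0 := by
  have h15 : √(15 : ℝ) = √5 * √3 := by rw [← Real.sqrt_mul (by norm_num)]; norm_num
  have h14 : √(14 : ℝ) = √2 * √7 := by rw [← Real.sqrt_mul (by norm_num)]; norm_num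
  have hdet : (Matrix.of fun i j => (Z₁ i j).im).det = √15 - √14 := by
    simp [Matrix.det_fin_two, Z₁, h15, h14]
  have hpos : 0 < √(15 : ℝ) - √14 :=
    sub_pos.2 (Real.sqrt_lt_sqrt (by norm_num) (by norm_num))
  have hM : Z₁ ∈ Mset := by
    change 0 < (Matrix.of fun i j => (Z₁ i j).im).det
    rwa [hdet]
  have hS : ∀ n : ℕ, 1 ≤ n → Z₁ ∉ Sn n := by
    rintro n - ⟨-, h⟩
    have him : √(7 : ℝ) = n * √2 := by simpa [Z₁] using congrArg Complex.im h
    have := int_combination_sqrt_five_two_seven_three (a := 0) (b := n) (c := -1) (d := 0) (by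
      push_cast
      linear_combination -him)
    simp at this
  have hR : ∀ m : Fin 6 → ℤ, Admissible m → Z₁ ∉ Rm m := by
    rintro m ⟨i, hi, hmi⟩ ⟨-, h⟩
    have hre := congrArg Complex.re h
    have him := congrArg Complex.im h
    simp [Z₁] at hre him
    obtain ⟨h1, h2, h3, h4⟩ := int_combination_sqrt_five_two_seven_three him
    obtain ⟨-, h5, -⟩ := intCast_add_mul_sqrt_add_mul_sqrt_eq_zero (p := 15) (q := 14)
      (r := m 0) (x := -m 5) (y := m 5) (by decide +kernel) (by decide +kernel)
      (by decide +kernel) (by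
        push_cast [h15, h14]
        linear_combination hre)
    fin_cases i <;> simp_all
  refine ⟨hdet, hpos, hM, hS, hR, hM, ?_⟩
  simpa using ⟨hS, hR⟩
end
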